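/- arXiv:math/0112037 — 4 statements merged into one kernel-verified Lean document; each statement's English description precedes it below -/
import Mathlib

section
/- Let G be a finite group and let C₁, C₂, C₃ be conjugacy classes of G. Let T := {(σ₁,σ₂,σ₃) ∈ C₁ × C₂ × C₃ : σ₁σ₂σ₃ = 1}. Then T is invariant under the diagonal conjugation action of G, the quantity |C(σ₁) ∩ C(σ₂)| is constant on each G-orbit in T, and (1/|G|)·|T| = Σ_O 1/|C(σ₁ᴼ) ∩ C(σ₂ᴼ)|, where the sum runs over the G-orbits O in T and (σ₁ᴼ, σ₂ᴼ, σ₃ᴼ) is any representative of the orbit O. -/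
/-- `T` is the set of triples from the conjugacy classes of `γ₁, γ₂, γ₃` whose
product is `1`. -/
def tripleSet {G : Type*} [Group G] (γ₁ γ₂ γ₃ : G) : Set (G × G × G) :=
  {t | IsConj γ₁ t.1 ∧ IsConj γ₂ t.2.1 ∧ IsConj γ₃ t.2.2 ∧ t.1 * t.2.1 * t.2.2 = 1}

/-- `s` and `t` lie in the same orbit of the diagonal conjugation action of `G`
on `G³`. -/
def SameDiagConjOrbit {G : Type*} [Group G] (s t : G × G × G) : Prop :=
  ∃ τ : G, (τ * s.1 * τ⁻¹, τ * s.2.1 * τ⁻¹, τ * s.2.2 * τ⁻¹) = t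

section DiagonalConjugation

variable {G : Type*} [Group G]

theorem mem_centralizer_inf_centralizer_iff {a b g : G} :
    g ∈ (Subgroup.centralizer {a} ⊓ Subgroup.centralizer {b} : Subgroup G) ↔
      g * a * g⁻¹ = a ∧ g * b * g⁻¹ = b := by
  simp only [Subgroup.mem_inf, Subgroup.mem_centralizer_singleton_iff, mul_inv_eq_iff_eq_mul]

theorem card_centralizer_inf_centralizer_conj (a b τ : G) :
    Nat.card (Subgroup.centralizer {τ * a * τ⁻¹} ⊓
        Subgroup.centralizer {τ * b * τ⁻¹} : Subgroup G) =
      Nat.card (Subgroup.centralizer {a} ⊓ Subgroup.centralizer {b} : Subgroup G) := by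
  have conj_commute (g x : G) : τ * g * τ⁻¹ * (τ * x * τ⁻¹) * (τ * g * τ⁻¹)⁻¹ = τ * x * τ⁻¹ ↔
      g * x * g⁻¹ = x := by
    rw [show τ * g * τ⁻¹ * (τ * x * τ⁻¹) * (τ * g * τ⁻¹)⁻¹ = τ * (g * x * g⁻¹) * τ⁻¹ by group,
      mul_left_inj, mul_right_inj]
  refine (Nat.card_congr ((MulAut.conj τ).toEquiv.subtypeEquiv fun g => ?_)).symm
  simp only [mem_centralizer_inf_centralizer_iff, MulEquiv.toEquiv_eq_coe, EquivLike.coe_coe,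
    MulAut.conj_apply, conj_commute]

theorem conj_mem_tripleSet {γ₁ γ₂ γ₃ : G} {t : G × G × G} (ht : t ∈ tripleSet γ₁ γ₂ γ₃) (τ : G) :
    (τ * t.1 * τ⁻¹, τ * t.2.1 * τ⁻¹, τ * t.2.2 * τ⁻¹) ∈ tripleSet γ₁ γ₂ γ₃ := by
  obtain ⟨h₁, h₂, h₃, h⟩ := ht
  refine ⟨h₁.trans (isConj_iff.2 ⟨τ, rfl⟩), h₂.trans (isConj_iff.2 ⟨τ, rfl⟩),
    h₃.trans (isConj_iff.2 ⟨τ, rfl⟩), ?_⟩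
  rw [show τ * t.1 * τ⁻¹ * (τ * t.2.1 * τ⁻¹) * (τ * t.2.2 * τ⁻¹) =
    τ * (t.1 * t.2.1 * t.2.2) * τ⁻¹ by group, h, mul_one, mul_inv_cancel]

theorem mem_orbit_conjAct_iff {s t : G × G × G} :
    t ∈ MulAction.orbit (ConjAct G) s ↔ SameDiagConjOrbit s t :=
  ConjAct.toConjAct.toEquiv.symm.exists_congr_left.trans Iff.rfl

theorem card_stabilizer_conjAct {t : G × G × G} (h : t.1 * t.2.1 * t.2.2 = 1) :
    Nat.card (MulAction.stabilizer (ConjAct G) t) =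
      Nat.card (Subgroup.centralizer {t.1} ⊓ Subgroup.centralizer {t.2.1} : Subgroup G) := by
  refine Nat.card_congr (ConjAct.ofConjAct.toEquiv.subtypeEquiv fun g => ?_)
  have h₃ : t.2.2 = (t.1 * t.2.1)⁻¹ := (inv_eq_of_mul_eq_one_right h).symm
  rw [MulAction.mem_stabilizer_iff, mem_centralizer_inf_centralizer_iff]
  change g • t = t ↔ g • t.1 = t.1 ∧ g • t.2.1 = t.2.1
  rw [Prod.ext_iff, Prod.ext_iff]
  change g • t.1 = t.1 ∧ g • t.2.1 = t.2.1 ∧ g • t.2.2 = t.2.2 ↔ _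
  refine ⟨fun hg => ⟨hg.1, hg.2.1⟩, fun hg => ⟨hg.1, hg.2, ?_⟩⟩
  rw [h₃, smul_inv', smul_mul', hg.1, hg.2]

theorem card_tripleSet_eq_sum_card_orbit [Finite G] {γ₁ γ₂ γ₃ : G} {R : Finset (G × G × G)}
    (hR : ↑R ⊆ tripleSet γ₁ γ₂ γ₃)
    (hT : ∀ t ∈ tripleSet γ₁ γ₂ γ₃, ∃! s, s ∈ R ∧ SameDiagConjOrbit s t) :
    Nat.card (tripleSet γ₁ γ₂ γ₃) = ∑ s ∈ R, Nat.card (MulAction.orbit (ConjAct G) s) := by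
  have mem_of_orbit {s t : G × G × G} (hs : s ∈ R) (hst : SameDiagConjOrbit s t) :
      t ∈ tripleSet γ₁ γ₂ γ₃ := by
    obtain ⟨τ, rfl⟩ := hst
    exact conj_mem_tripleSet (hR hs) τ
  have hunion : tripleSet γ₁ γ₂ γ₃ = ⋃ s ∈ R, MulAction.orbit (ConjAct G) s := by
    ext t
    simp only [Set.mem_iUnion, mem_orbit_conjAct_iff, exists_prop]
    exact ⟨fun ht => (hT t ht).exists, fun ⟨s, hs, hst⟩ => mem_of_orbit hs hst⟩
  have hdisj : (R : Set (G × G × G)).PairwiseDisjoint (MulAction.orbit (ConjAct G)) := by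
    intro s hs s' hs' hne
    refine Set.disjoint_left.2 fun t ht ht' => hne ?_
    rw [mem_orbit_conjAct_iff] at ht ht'
    exact (hT t (mem_of_orbit hs ht)).unique ⟨hs, ht⟩ ⟨hs', ht'⟩
  rw [hunion, Nat.card_coe_set_eq, ← finsum_mem_coe_finset]
  exact R.finite_toSet.ncard_biUnion (fun _ _ => Set.toFinite _) hdisj

end DiagonalConjugation

/-- Let `T := {(σ₁,σ₂,σ₃) ∈ C₁ × C₂ × C₃ : σ₁σ₂σ₃ = 1}`.  Then `T` is invariant
under diagonal conjugation, `|C(σ₁) ∩ C(σ₂)|` is constant on each orbit, and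
`(1/|G|)·|T| = Σ_O 1/|C(σ₁ᴼ) ∩ C(σ₂ᴼ)|`, the sum running over any complete set
`R` of representatives of the `G`-orbits in `T`. -/
theorem tripleSet_orbit_sum
    (G : Type*) [Group G] [Fintype G] (γ₁ γ₂ γ₃ : G) :
    (∀ t ∈ tripleSet γ₁ γ₂ γ₃, ∀ τ : G,
        (τ * t.1 * τ⁻¹, τ * t.2.1 * τ⁻¹, τ * t.2.2 * τ⁻¹) ∈ tripleSet γ₁ γ₂ γ₃) ∧
    (∀ t ∈ tripleSet γ₁ γ₂ γ₃, ∀ τ : G,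
        Nat.card (Subgroup.centralizer {τ * t.1 * τ⁻¹} ⊓
            Subgroup.centralizer {τ * t.2.1 * τ⁻¹} : Subgroup G) =
          Nat.card (Subgroup.centralizer {t.1} ⊓
            Subgroup.centralizer {t.2.1} : Subgroup G)) ∧
    (∀ R : Finset (G × G × G), ↑R ⊆ tripleSet γ₁ γ₂ γ₃ →
        (∀ t ∈ tripleSet γ₁ γ₂ γ₃, ∃! s, s ∈ R ∧ SameDiagConjOrbit s t) →
        (1 / (Nat.card G : ℚ)) * Nat.card (tripleSet γ₁ γ₂ γ₃) =
          ∑ s ∈ R, 1 / (Nat.card (Subgroup.centralizer {s.1} ⊓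
            Subgroup.centralizer {s.2.1} : Subgroup G) : ℚ)) := by
  refine ⟨fun t ht τ => conj_mem_tripleSet ht τ,
    fun t _ τ => card_centralizer_inf_centralizer_conj t.1 t.2.1 τ, fun R hR hT => ?_⟩
  rw [card_tripleSet_eq_sum_card_orbit hR hT, Nat.cast_sum, Finset.mul_sum]
  refine Finset.sum_congr rfl fun s hs => ?_
  have horbit : Nat.card (MulAction.orbit (ConjAct G) s) *
      Nat.card (Subgroup.centralizer {s.1} ⊓ Subgroup.centralizer {s.2.1} : Subgroup G) =
        Nat.card G := by
    rw [← card_stabilizer_conjAct (hR hs).2.2.2, ← Nat.card_prod]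
    exact Nat.card_congr (MulAction.orbitProdStabilizerEquivGroup (ConjAct G) s)
  have hG : (Nat.card G : ℚ) ≠ 0 := Nat.cast_ne_zero.2 Nat.card_pos.ne'
  rw [← horbit, Nat.cast_mul] at hG ⊢
  have := left_ne_zero_of_mul hG
  have := right_ne_zero_of_mul hG
  field_simp
end

section
/- Let G be a finite group and V a finite-dimensional irreducible complex representation of G. Then the element f_V := (dim V / |G|) Σ_{σ∈G} χ_V(σ⁻¹)·σ of ℂ[G] is idempotent: f_V · f_V = f_V. -/
open CategoryTheory

/-- For a finite-dimensional complex representation `V` of a finite group `G`,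
`f_V := (dim V / |G|) Σ_{σ∈G} χ_V(σ⁻¹)·σ ∈ ℂ[G]`. -/
noncomputable def fV (G : Type) [Group G] [Fintype G] (V : FDRep ℂ G) :
    MonoidAlgebra ℂ G :=
  ∑ σ : G, MonoidAlgebra.single σ
    ((Module.finrank ℂ V : ℂ) / (Fintype.card G) * V.character σ⁻¹)

namespace FDRep

/-- **Schur's lemma** for linear maps: over an algebraically closed field, a linear endomorphism of
a simple representation which commutes with the action is a scalar. -/
theorem exists_eq_smul_id_of_commute {k : Type*} [Field k] [IsAlgClosed k] {G : Type*} [Monoid G]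
    (V : FDRep k G) [Simple V] (T : V →ₗ[k] V) (hT : ∀ g, Commute T (V.ρ g)) :
    ∃ c : k, T = c • LinearMap.id := by
  let f : V ⟶ V := ⟨InducedCategory.homMk (ModuleCat.ofHom T), fun g ↦ by
    ext1
    exact hT g⟩
  obtain ⟨c, hc⟩ := endomorphism_simple_eq_smul_id k f
  exact ⟨c, congr(($hc).hom.hom.hom).symm⟩

/-- The convolution of the character of an irreducible representation with itself is a multiple
of the character. -/
theorem finrank_mul_sum_character_mul_character {k : Type*} [Field k] [IsAlgClosed k] [CharZero k]
    {G : Type*} [Group G] [Fintype G] (V : FDRep k G) [Simple V] (τ : G) :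
    (Module.finrank k V : k) * ∑ σ : G, V.character σ⁻¹ * V.character (τ * σ) =
      Fintype.card G * V.character τ := by
  have hcard : (Nat.card G : k) ≠ 0 := Nat.cast_ne_zero.mpr Nat.card_pos.ne'
  let T : V →ₗ[k] V := ∑ σ : G, V.character σ⁻¹ • V.ρ σ
  have hT (g : G) : Commute T (V.ρ g) := by
    change T * V.ρ g = V.ρ g * T
    simp only [T, Finset.sum_mul, Finset.mul_sum, smul_mul_assoc, mul_smul_comm, ← map_mul]
    refine Fintype.sum_equiv (MulAut.conj g⁻¹).toEquiv _ _ fun σ ↦ ?_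
    have h := V.char_conj σ⁻¹ g⁻¹
    rw [inv_inv, mul_assoc] at h
    simp [mul_assoc, h]
  obtain ⟨c, hc⟩ := V.exists_eq_smul_id_of_commute T hT
  have htrace (g : G) :
      ∑ σ : G, V.character σ⁻¹ * V.character (g * σ) = c * V.character g := by
    have h := congr(LinearMap.trace k V (V.ρ g * $hc))
    simp only [T, Finset.mul_sum, mul_smul_comm, ← map_mul, map_sum, map_smul, smul_eq_mul,
      ← Module.End.one_eq_id, mul_one] at h
    exact h
  have hdim : c * Module.finrank k V = Fintype.card G := by
    let := invertibleOfNonzero hcard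
    have h := V.char_orthonormal V
    rw [if_pos ⟨Iso.refl V⟩, inv_mul_eq_iff_eq_mul₀ hcard, mul_one] at h
    rw [← V.char_one, ← htrace 1, ← Nat.card_eq_fintype_card, ← h]
    exact Finset.sum_congr rfl fun σ _ ↦ by rw [one_mul, mul_comm]
  rw [htrace, ← hdim]
  ring

end FDRep

/-- For an irreducible finite-dimensional complex representation `V` of a
finite group `G`, the element `f_V ∈ ℂ[G]` is idempotent. -/
theorem fV_idempotent
    (G : Type) [Group G] [Fintype G] (V : FDRep ℂ G) [Simple V] :
    fV G V * fV G V = fV G V := by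
  have hcard : (Fintype.card G : ℂ) ≠ 0 := Nat.cast_ne_zero.mpr Fintype.card_ne_zero
  simp only [fV, Finset.sum_mul_sum, MonoidAlgebra.single_mul_single]
  have hreindex (σ : G) := Equiv.sum_comp (Equiv.mulLeft σ⁻¹) fun τ ↦ MonoidAlgebra.single (σ * τ)
    ((Module.finrank ℂ V : ℂ) / Fintype.card G * V.character σ⁻¹ *
      (Module.finrank ℂ V / Fintype.card G * V.character τ⁻¹))
  simp only [← hreindex, Equiv.coe_mulLeft, mul_inv_cancel_left, mul_inv_rev, inv_inv]
  rw [Finset.sum_comm]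
  refine Finset.sum_congr rfl fun τ _ ↦ ?_
  simp only [← MonoidAlgebra.singleAddHom_apply, ← map_sum]
  congr 1
  have h := V.finrank_mul_sum_character_mul_character τ⁻¹
  simp only [mul_mul_mul_comm _ (V.character _), ← Finset.mul_sum]
  field_simp
  linear_combination (Module.finrank ℂ V : ℂ) * h
end

section
/- Let G be a finite group and let V and W be finite-dimensional irreducible complex representations of G that are not isomorphic. Then f_V · f_W = 0 in ℂ[G], where f_V := (dim V / |G|) Σ_{σ∈G} χ_V(σ⁻¹)·σ and f_W := (dim W / |G|) Σ_{σ∈G} χ_W(σ⁻¹)·σ. -/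
open CategoryTheory

namespace LinearMap

/-- The trace of the two-sided composition map `A ↦ P ∘ A ∘ Q` is `tr P * tr Q`. -/
theorem trace_llcomp_comp_lcomp {k V W : Type*} [CommRing k] [AddCommGroup V] [Module k V]
    [Module.Free k V] [Module.Finite k V] [AddCommGroup W] [Module k W] [Module.Free k W]
    [Module.Finite k W]
    (P : W →ₗ[k] W) (Q : V →ₗ[k] V) :
    trace k (V →ₗ[k] W) (llcomp k V W W P ∘ₗ lcomp k W Q) = trace k W P * trace k V Q := by
  have key : llcomp k V W W P ∘ₗ lcomp k W Q =
      (dualTensorHomEquiv k V W).conj (TensorProduct.map (Module.Dual.transpose Q) P) := by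
    refine (LinearEquiv.eq_comp_toLinearMap_symm (e₁₂ := dualTensorHomEquiv k V W) _ _).mpr ?_
    ext f w v
    simp [Module.Dual.transpose_apply]
  rw [key, trace_conj' (M := TensorProduct k (Module.Dual k V) W) (N := V →ₗ[k] W),
    trace_tensorProduct', trace_transpose', mul_comm]

end LinearMap

namespace FDRep

variable {G : Type} [Group G] [Fintype G]

/-- Schur's lemma in averaged form. -/
theorem sum_linHom_eq_zero_of_not_iso (V W : FDRep ℂ G) [Simple V] [Simple W]
    (h : ¬ Nonempty (V ≅ W)) :
    ∑ σ : G, Representation.linHom V.ρ W.ρ σ = 0 := by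
  ext1 A
  have hA : (∑ σ : G, Representation.linHom V.ρ W.ρ σ) A ∈
      (Representation.linHom V.ρ W.ρ).invariants := by
    intro τ
    rw [LinearMap.sum_apply, map_sum]
    refine Fintype.sum_equiv (Equiv.mulLeft τ) _ _ fun σ => ?_
    simp only [Equiv.coe_mulLeft, map_mul, Module.End.mul_apply]
  let e := Representation.linHom.invariantsEquivFDRepHom V W
  have h_zero : e ⟨_, hA⟩ = 0 := by
    by_contra hne
    have := isIso_of_hom_simple hne
    exact h ⟨asIso (e ⟨_, hA⟩)⟩
  exact congrArg Subtype.val ((LinearEquiv.map_eq_zero_iff e).mp h_zero)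

/-- The convolution of two distinct irreducible characters vanishes. -/
theorem sum_character_mul_character_eq_zero_of_not_iso (V W : FDRep ℂ G) [Simple V] [Simple W]
    (h : ¬ Nonempty (V ≅ W)) (τ : G) :
    ∑ σ : G, V.character σ⁻¹ * W.character (τ * σ) = 0 := by
  have key : ∀ σ : G, V.character σ⁻¹ * W.character (τ * σ) =
      LinearMap.trace ℂ (V →ₗ[ℂ] W)
        ((LinearMap.llcomp ℂ V W W (W.ρ τ) : Module.End ℂ (V →ₗ[ℂ] W)) *
          Representation.linHom V.ρ W.ρ σ) := by
    intro σ
    rw [mul_comm, character, character, ← LinearMap.trace_llcomp_comp_lcomp]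
    congr 1
    ext A v
    simp [Representation.linHom_apply]
  simp_rw [key]
  rw [← map_sum, ← Finset.mul_sum, sum_linHom_eq_zero_of_not_iso V W h, mul_zero, map_zero]

end FDRep

/-- For non-isomorphic irreducible finite-dimensional complex representations
`V` and `W` of a finite group `G`, one has `f_V · f_W = 0` in `ℂ[G]`. -/
theorem fV_mul_fV_of_not_iso
    (G : Type) [Group G] [Fintype G] (V W : FDRep ℂ G) [Simple V] [Simple W]
    (h : ¬ Nonempty (V ≅ W)) :
    fV G V * fV G W = 0 := by
  simp only [fV, Finset.sum_mul, Finset.mul_sum, MonoidAlgebra.single_mul_single]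
  have reindex : ∀ σ : G, ∑ τ : G, MonoidAlgebra.single (σ * τ)
        ((Module.finrank ℂ V : ℂ) / Fintype.card G * V.character σ⁻¹ *
          ((Module.finrank ℂ W : ℂ) / Fintype.card G * W.character τ⁻¹)) =
      ∑ τ : G, MonoidAlgebra.single τ
        ((Module.finrank ℂ V : ℂ) / Fintype.card G * ((Module.finrank ℂ W : ℂ) / Fintype.card G) *
          (V.character σ⁻¹ * W.character (τ⁻¹ * σ))) := by
    intro σ
    refine Fintype.sum_equiv (Equiv.mulLeft σ) _ _ fun τ => ?_
    simp only [Equiv.coe_mulLeft, mul_inv_rev, inv_mul_cancel_right]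
    congr 1
    ring
  rw [Finset.sum_comm, Finset.sum_congr rfl fun σ _ => reindex σ, Finset.sum_comm]
  refine Finset.sum_eq_zero fun τ _ => ?_
  have hs := FDRep.sum_character_mul_character_eq_zero_of_not_iso V W h τ⁻¹
  simp only [← MonoidAlgebra.singleAddHom_apply]
  rw [← map_sum, ← Finset.mul_sum, hs, mul_zero, map_zero]
end

section
/- For every pair of integers m, n ≥ −1, the operators L_m and L_n on R satisfy the Virasoro relation [L_m, L_n] = L_m ∘ L_n − L_n ∘ L_m = (m−n)·L_{m+n}. -/
/-- The odd double factorial: `doubleFac n = n!!`, so that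
`doubleFac (2k+1) = 1·3·5⋯(2k+1)` and `doubleFac 0 = 1`
(encoding `(−1)!! = 1` via `Int.toNat`). -/
def doubleFac : ℕ → ℕ
  | 0 => 1
  | 1 => 1
  | (n + 2) => (n + 2) * doubleFac n

/-- The coefficient ring `A := ℚ[λ, λ⁻¹]` (Laurent polynomials in `λ`). -/
abbrev ALaur : Type := LaurentPolynomial ℚ

/-- The large phase space ring `R := A[u₀, u₁, u₂, …]`. -/
abbrev RPoly : Type := MvPolynomial ℕ ALaur

/-- The Virasoro operator
`L_n := −((2n+3)!!/2^{n+1})·∂_{n+1}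
  + Σ_{i ≥ 0, i+n ≥ 0} ((2i+2n+1)!!/((2i−1)!!·2^{n+1}))·uᵢ·∂_{i+n}
  + (λ²/2)·Σ_{i=0}^{n−1} ((2i+1)!!·(2n−2i−1)!!/2^{n+1})·∂ᵢ∂_{n−1−i}
  + δ_{n,−1}·(λ^{−2}/2)·(u₀²·) + δ_{n,0}·(1/16)·id`
on `R`, for integers `n ≥ −1`. -/
noncomputable def Lop (n : ℤ) : RPoly → RPoly := fun p =>
  -(LaurentPolynomial.C ((doubleFac (2 * n + 3).toNat : ℚ) / 2 ^ (n + 1).toNat) •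
      MvPolynomial.pderiv (n + 1).toNat p)
  + (∑ᶠ i : ℕ, if 0 ≤ (i : ℤ) + n then
      LaurentPolynomial.C ((doubleFac (2 * (i : ℤ) + 2 * n + 1).toNat : ℚ) /
          ((doubleFac (2 * (i : ℤ) - 1).toNat : ℚ) * 2 ^ (n + 1).toNat)) •
        (MvPolynomial.X i * MvPolynomial.pderiv ((i : ℤ) + n).toNat p)
    else 0)
  + (LaurentPolynomial.T 2 * LaurentPolynomial.C (1 / 2 : ℚ)) •
      (∑ i ∈ Finset.range n.toNat,
        LaurentPolynomial.C (((doubleFac (2 * i + 1) : ℚ) *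
            (doubleFac (2 * n - 2 * (i : ℤ) - 1).toNat : ℚ)) / 2 ^ (n + 1).toNat) •
          MvPolynomial.pderiv i (MvPolynomial.pderiv (n - 1 - (i : ℤ)).toNat p))
  + (if n = -1 then
      (LaurentPolynomial.T (-2) * LaurentPolynomial.C (1 / 2 : ℚ)) •
        (MvPolynomial.X 0 * MvPolynomial.X 0 * p)
    else 0)
  + (if n = 0 then LaurentPolynomial.C (1 / 16 : ℚ) • p else 0)

/-- `oddFac k = (2k−1)!!` as a rational number. -/
def oddFac (k : ℕ) : ℚ := doubleFac (2 * k - 1)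

lemma oddFac_zero : oddFac 0 = 1 := by simp [oddFac, doubleFac]

lemma oddFac_succ (k : ℕ) : oddFac (k + 1) = (2 * k + 1) * oddFac k := by
  cases k with
  | zero => simp [oddFac, doubleFac]
  | succ k =>
    have h : 2 * (k + 1 + 1) - 1 = (2 * k + 1) + 2 := by omega
    have h' : 2 * (k + 1) - 1 = 2 * k + 1 := by omega
    simp only [oddFac, h, h', doubleFac]
    push_cast
    ring

lemma oddFac_ne_zero (k : ℕ) : oddFac k ≠ 0 := by
  induction k with
  | zero => simp [oddFac_zero]
  | succ k ih =>
    rw [oddFac_succ]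
    exact mul_ne_zero (by positivity) ih

lemma doubleFac_toNat {z : ℤ} {k : ℕ} (h : z = 2 * k - 1) :
    (doubleFac z.toNat : ℚ) = oddFac k := by
  have h' : z.toNat = 2 * k - 1 := by omega
  rw [h', oddFac]

/-- A polynomial-like commutative algebra: generators `uₖ`, the partial derivatives `∂ᵢ`, and the
linear vector fields `Σ_{i + N ≥ 1} ((2i+2N−1)!!/((2i−1)!!·2^N))·uᵢ·∂_{i+N−1}`. -/
structure VirasoroSetting {A : Type*} [CommRing A] (c : ℚ →+* A) (P : Type*) [CommRing P]
    [Algebra A P] where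
  /-- the generators `uₖ` -/
  var : ℕ → P
  /-- the partial derivatives `∂ᵢ` -/
  der : ℕ → Derivation A P P
  /-- the linear vector fields -/
  field : ℕ → Derivation A P P
  adjoin_var : Algebra.adjoin A (Set.range var) = ⊤
  der_var : ∀ i k, der i (var k) = if i = k then 1 else 0
  field_var : ∀ N k, field N (var k) =
    if N ≤ k + 1 then c (oddFac (k + 1) / (oddFac (k + 1 - N) * 2 ^ N)) • var (k + 1 - N) else 0

namespace VirasoroSetting

variable {A P : Type*} [CommRing A] [CommRing P] [Algebra A P] {c : ℚ →+* A}
  (W : VirasoroSetting c P) (t s : A)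

attribute [local instance] LieRing.ofAssociativeRing

lemma derivation_ext {D₁ D₂ : Derivation A P P} (h : ∀ k, D₁ (W.var k) = D₂ (W.var k)) :
    D₁ = D₂ := by
  refine Derivation.ext_of_adjoin_eq_top _ W.adjoin_var ?_
  rintro _ ⟨k, rfl⟩
  exact h k

lemma apply_eq_mul (T : Module.End A P) (h : ∀ k q, T (W.var k * q) = W.var k * T q) (p : P) :
    T p = p * T 1 := by
  suffices ∀ q, T (p * q) = p * T q by simpa using this 1
  have hp : p ∈ Algebra.adjoin A (Set.range W.var) := W.adjoin_var ▸ Algebra.mem_top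
  induction hp using Algebra.adjoin_induction with
  | mem x hx =>
    obtain ⟨k, rfl⟩ := hx
    exact h k
  | algebraMap a => simp [← Algebra.smul_def]
  | add x y _ _ hx hy => simp [add_mul, hx, hy]
  | mul x y _ _ hx hy => simp [mul_assoc, hx, hy]

/-- The partial derivative `∂ᵢ` as an endomorphism. -/
noncomputable def derEnd (i : ℕ) : Module.End A P :=
  (W.der i : Derivation A P P).toLinearMap

/-- Multiplication by a polynomial as an endomorphism. -/
noncomputable def mulEnd (A : Type*) {P : Type*} [CommRing A] [CommRing P] [Algebra A P]
    (f : P) : Module.End A P :=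
  LinearMap.mulLeft A f

/-- The operator `L_{N−1}` as an `A`-linear endomorphism. -/
noncomputable def virasoroEnd (N : ℕ) : Module.End A P :=
  -(c (oddFac (N + 1) / 2 ^ N) • W.derEnd N)
  + (W.field N).toLinearMap
  + (t * c (1 / 2 : ℚ)) •
      ∑ i ∈ Finset.range (N - 1),
        c (oddFac (i + 1) * oddFac (N - 1 - i) / 2 ^ N) •
          (W.derEnd i * W.derEnd (N - 2 - i))
  + (if N = 0 then
      (s * c (1 / 2 : ℚ)) • mulEnd A (W.var 0 * W.var 0)
    else 0)
  + (if N = 1 then c (1 / 16 : ℚ) • 1 else 0)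

lemma lie_mulEnd (D : Derivation A P P) (f : P) :
    ⁅D.toLinearMap, mulEnd A f⁆ = mulEnd A (D f) := by
  refine LinearMap.ext fun p => ?_
  simp [Ring.lie_def, mulEnd, mul_comm]

lemma mulEnd_lie_mulEnd (f g : P) : ⁅mulEnd A f, mulEnd A g⁆ = 0 := by
  refine LinearMap.ext fun p => ?_
  simp [Ring.lie_def, mulEnd, mul_left_comm]

lemma mulEnd_zero : mulEnd A (0 : P) = 0 := by
  simp [mulEnd]

lemma mulEnd_one : mulEnd A (1 : P) = 1 := by
  refine LinearMap.ext fun p => ?_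
  simp [mulEnd]

lemma mulEnd_smul (a : A) (f : P) : mulEnd A (a • f) = a • mulEnd A f := by
  refine LinearMap.ext fun p => ?_
  simp [mulEnd]

lemma mulEnd_mul (f g : P) : mulEnd A (f * g) = mulEnd A f * mulEnd A g := by
  refine LinearMap.ext fun p => ?_
  simp [mulEnd]

lemma derEnd_lie_X (i k : ℕ) :
    ⁅(W.derEnd i : Module.End A P), mulEnd A (W.var k)⁆ = if i = k then 1 else 0 := by
  rw [derEnd, lie_mulEnd]
  split_ifs with h
  · rw [h, W.der_var, if_pos rfl, mulEnd_one]
  · rw [W.der_var, if_neg h, mulEnd_zero]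

lemma derEnd_commute (i j : ℕ) :
    (W.derEnd i : Module.End A P) * W.derEnd j = W.derEnd j * W.derEnd i := by
  have h : ⁅(W.der i : Derivation A P P), (W.der j : Derivation A P P)⁆ = 0 := by
    refine W.derivation_ext fun k => ?_
    rw [Derivation.commutator_apply]
    simp [W.der_var, apply_ite]
  refine LinearMap.ext fun p => ?_
  have h := congrArg (fun D => D p) h
  simp only [Derivation.commutator_apply, Derivation.zero_apply, sub_eq_zero] at h
  exact h

lemma mul_lie_eq (a b c : Module.End A P) : ⁅a * b, c⁆ = a * ⁅b, c⁆ + ⁅a, c⁆ * b := by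
  simp only [Ring.lie_def, mul_sub, sub_mul, mul_assoc]
  abel

lemma field_lie_derEnd (N j : ℕ) : ⁅(W.field N).toLinearMap, (W.derEnd j : Module.End A P)⁆ =
    if 1 ≤ j + N then
      -(c (oddFac (j + N) / (oddFac j * 2 ^ N)) • W.derEnd (j + N - 1))
    else 0 := by
  have h : ⁅W.field N, (W.der j : Derivation A P P)⁆ = if 1 ≤ j + N then
      -(c (oddFac (j + N) / (oddFac j * 2 ^ N)) • W.der (j + N - 1))
    else 0 := by
    refine W.derivation_ext fun k => ?_
    rw [Derivation.commutator_apply]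
    have h1 : W.field N (W.der j (W.var k)) = 0 := by
      rw [W.der_var]
      split_ifs <;> simp
    rw [h1, W.field_var, zero_sub]
    by_cases hk : j + N = k + 1
    · rw [if_pos (by omega), if_pos (by omega), ← hk, show j + N - N = j by omega,
        show j + N - 1 = k by omega]
      simp [W.der_var]
    · have h2 : ∀ a : A, W.der j (if N ≤ k + 1 then a • W.var (k + 1 - N) else (0 : P)) = 0 := by
        intro a
        split_ifs
        · rw [Derivation.map_smul, W.der_var, if_neg (by omega), smul_zero]
        · simp
      rw [h2]
      split_ifs
      · simp [W.der_var, show j + N - 1 ≠ k by omega]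
      · simp
  rw [derEnd, ← Derivation.commutator_coe_linear_map, h]
  split_ifs <;> rfl

/-- The modes: `qₖ/(2k−1)!!` with `qₖ = uₖ − δ_{k,1}` for `k ≥ 0`, and
`λ²·(2j+1)!!·∂ⱼ` for `k = −1−j < 0`. -/
noncomputable def mode : ℤ → Module.End A P
  | Int.ofNat k =>
      c (1 / oddFac k) • (mulEnd A (W.var k) - if k = 1 then 1 else 0)
  | Int.negSucc j => (t * c (oddFac (j + 1))) • W.derEnd j

lemma mode_natCast (k : ℕ) : W.mode t k =
    c (1 / oddFac k) • (mulEnd A (W.var k) - if k = 1 then 1 else 0) := rfl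

lemma mode_neg {z : ℤ} (j : ℕ) (h : z = -1 - j) :
    W.mode t z = (t * c (oddFac (j + 1))) • W.derEnd j := by
  rw [show z = Int.negSucc j by omega]
  rfl

lemma one_lie_end (a : Module.End A P) : ⁅(1 : Module.End A P), a⁆ = 0 := by
  simp [Ring.lie_def]

lemma lie_one_end (a : Module.End A P) : ⁅a, (1 : Module.End A P)⁆ = 0 := by
  simp [Ring.lie_def]

lemma lie_smul_end (r : A) (a b : Module.End A P) : ⁅a, r • b⁆ = r • ⁅a, b⁆ := by
  simp only [Ring.lie_def, mul_smul_comm, smul_mul_assoc, smul_sub]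

lemma virasoroEnd_lie_X (N k : ℕ) : ⁅W.virasoroEnd t s N, mulEnd A (W.var k)⁆ =
    c (oddFac (k + 1) / 2 ^ N) • W.mode t (k + 1 - N) := by
  have hQ : ⁅(if N = 0 then (s * c (1 / 2 : ℚ)) •
      mulEnd A (W.var 0 * W.var 0) else 0 : Module.End A P), mulEnd A (W.var k)⁆ = 0 := by
    split_ifs
    · rw [smul_lie, mulEnd_lie_mulEnd, smul_zero]
    · exact zero_lie _
  have hI : ⁅(if N = 1 then c (1 / 16 : ℚ) • 1 else 0 : Module.End A P),
      mulEnd A (W.var k)⁆ = 0 := by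
    split_ifs
    · rw [smul_lie, one_lie_end, smul_zero]
    · exact zero_lie _
  rw [virasoroEnd, add_lie, add_lie, add_lie, add_lie, hQ, hI, neg_lie, smul_lie, smul_lie,
    sum_lie, lie_mulEnd, W.derEnd_lie_X, W.field_var]
  simp only [smul_lie, mul_lie_eq, W.derEnd_lie_X, add_zero]
  by_cases h : N ≤ k + 1
  · rw [Finset.sum_eq_zero, if_pos h, mulEnd_smul, smul_zero, add_zero,
      show (k : ℤ) + 1 - N = ((k + 1 - N : ℕ) : ℤ) by omega, W.mode_natCast]
    · by_cases hk : N = k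
      · subst hk
        simp only [add_tsub_cancel_left, if_true]
        have h1 : oddFac 1 = 1 := by simp [oddFac, doubleFac]
        simp only [h1, one_mul, div_one, map_one, one_smul]
        module
      · rw [if_neg hk, if_neg (by omega), smul_zero, neg_zero, zero_add, sub_zero, smul_smul,
          ← map_mul]
        congr 3
        have := oddFac_ne_zero (k + 1 - N)
        field_simp
    · intro i hi
      rw [Finset.mem_range] at hi
      rw [if_neg (by omega), if_neg (by omega)]
      simp
  · rw [if_neg h, if_neg (by omega), W.mode_neg t (N - 2 - k) (by omega), mulEnd_zero]
    have hs : ∀ i ∈ Finset.range (N - 1),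
        c (oddFac (i + 1) * oddFac (N - 1 - i) / 2 ^ N) •
        (W.derEnd i * (if N - 2 - i = k then 1 else 0 : Module.End A P) +
          (if i = k then 1 else 0 : Module.End A P) * W.derEnd (N - 2 - i)) =
        (if i = N - 2 - k then c (oddFac (k + 1) * oddFac (N - 2 - k + 1) / 2 ^ N) •
          W.derEnd (N - 2 - k) else 0) +
        (if i = k then c (oddFac (k + 1) * oddFac (N - 2 - k + 1) / 2 ^ N) •
          W.derEnd (N - 2 - k) else 0) := by
      intro i hi
      rw [Finset.mem_range] at hi
      rw [smul_add]
      congr 1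
      · by_cases hik : i = N - 2 - k
        · rw [if_pos hik, if_pos (by omega), mul_one, hik,
            show N - 1 - (N - 2 - k) = k + 1 by omega, mul_comm (oddFac (k + 1))]
        · rw [if_neg hik, if_neg (by omega), mul_zero, smul_zero]
      · by_cases hik : i = k
        · rw [if_pos hik, if_pos hik, hik, one_mul, show N - 1 - k = N - 2 - k + 1 by omega]
        · rw [if_neg hik, if_neg hik, zero_mul, smul_zero]
    rw [Finset.sum_congr rfl hs, Finset.sum_add_distrib, Finset.sum_ite_eq', Finset.sum_ite_eq',
      if_pos (by rw [Finset.mem_range]; omega), if_pos (by rw [Finset.mem_range]; omega),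
      ← two_smul A]
    simp only [smul_zero, neg_zero, zero_add, smul_smul]
    congr 1
    have h2 : (2 : A) = c 2 := (map_ofNat c 2).symm
    rw [h2]
    calc _ = t * c
          (1 / 2 * 2 * (oddFac (k + 1) * oddFac (N - 2 - k + 1) / 2 ^ N)) := by
          simp only [map_mul]; ring
      _ = t * c
          (oddFac (k + 1) / 2 ^ N * oddFac (N - 2 - k + 1)) := by
          congr 2; ring
      _ = _ := by rw [map_mul]; ring

lemma virasoroEnd_lie_derEnd (N j : ℕ) : ⁅W.virasoroEnd t s N, W.derEnd j⁆ =
    if 1 ≤ j + N then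
      -(c (oddFac (j + N) / (oddFac j * 2 ^ N)) • W.derEnd (j + N - 1))
    else -(s • mulEnd A (W.var 0)) := by
  have hc : ∀ i k, ⁅(W.derEnd i : Module.End A P), W.derEnd k⁆ = 0 := fun i k => by
    rw [Ring.lie_def, W.derEnd_commute, sub_self]
  have hI : ⁅(if N = 1 then c (1 / 16 : ℚ) • 1 else 0 : Module.End A P),
      W.derEnd j⁆ = 0 := by
    split_ifs
    · rw [smul_lie, one_lie_end, smul_zero]
    · exact zero_lie _
  rw [virasoroEnd, add_lie, add_lie, add_lie, add_lie, hI, neg_lie, smul_lie, smul_lie,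
    sum_lie, W.field_lie_derEnd, hc]
  simp only [smul_lie, mul_lie_eq, hc, mul_zero, zero_mul, add_zero, smul_zero,
    Finset.sum_const_zero, neg_zero, zero_add]
  have hQ : ⁅mulEnd A (W.var 0 * W.var 0 : P), W.derEnd j⁆ =
      if j = 0 then -((2 : A) • mulEnd A (W.var 0)) else 0 := by
    rw [mulEnd_mul, mul_lie_eq, ← lie_skew, W.derEnd_lie_X]
    split_ifs
    · rw [two_smul]
      noncomm_ring
    · simp
  by_cases h : 1 ≤ j + N
  · rw [if_pos h, if_pos h]
    by_cases hN : N = 0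
    · rw [if_pos hN, smul_lie, hQ, if_neg (by omega), smul_zero, add_zero]
    · rw [if_neg hN, zero_lie, add_zero]
  · rw [if_neg h, if_neg h, if_pos (by omega), smul_lie, hQ, if_pos (by omega), smul_neg, zero_add,
      smul_smul, mul_assoc]
    congr 2
    have h2 : (2 : A) = c 2 := (map_ofNat c 2).symm
    rw [h2, ← map_mul]
    norm_num

lemma virasoroEnd_lie_mode (hts : t * s = 1) (N : ℕ) (i : ℤ) :
    ⁅W.virasoroEnd t s N, W.mode t i⁆ =
    c ((2 * i + 1) / 2 ^ N : ℚ) • W.mode t (i + 1 - N) := by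
  rcases lt_or_ge i 0 with hi | hi
  · obtain ⟨j, hj⟩ : ∃ j : ℕ, i = -1 - j := ⟨(-1 - i).toNat, by omega⟩
    rw [W.mode_neg t j hj, lie_smul_end, W.virasoroEnd_lie_derEnd]
    split_ifs with h
    · rw [W.mode_neg t (j + N - 1) (by omega), ← neg_smul, smul_smul, smul_smul, ← map_neg,
        show j + N - 1 + 1 = j + N by omega, mul_left_comm, mul_assoc, ← map_mul, ← map_mul,
        oddFac_succ]
      congr 3
      have := oddFac_ne_zero j
      rw [hj]
      push_cast
      field_simp
      ring
    · have hN : N = 0 := by omega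
      have hj0 : j = 0 := by omega
      subst hN hj0
      subst hj
      have : W.mode t ((-1 - (0 : ℕ) : ℤ) + 1 - (0 : ℕ)) = W.mode t (0 : ℕ) := by simp
      rw [this, W.mode_natCast]
      have h1 : oddFac 1 = 1 := by simp [oddFac, doubleFac]
      simp only [h1, oddFac_zero, zero_add, map_one, mul_one, smul_smul, div_one,
        if_neg zero_ne_one, sub_zero, one_smul, ← neg_smul]
      congr 1
      rw [mul_neg, hts, ← map_one c, ← map_neg]
      norm_num
  · obtain ⟨k, rfl⟩ := Int.eq_ofNat_of_zero_le hi
    have hk : ⁅W.virasoroEnd t s N, (if k = 1 then 1 else 0 : Module.End A P)⁆ = 0 := by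
      split_ifs
      · exact lie_one_end _
      · exact lie_zero _
    rw [W.mode_natCast, lie_smul_end, lie_sub, hk, sub_zero, W.virasoroEnd_lie_X, smul_smul, ← map_mul,
      oddFac_succ]
    congr 2
    have := oddFac_ne_zero k
    push_cast
    field_simp

/-- The defect of the Virasoro relation between `L_{M−1}` and `L_{N−1}`. -/
noncomputable def virasoroDefect (M N : ℕ) : Module.End A P :=
  ⁅W.virasoroEnd t s M, W.virasoroEnd t s N⁆ -
    c ((M : ℚ) - N) • W.virasoroEnd t s (M + N - 1)

lemma virasoroDefect_lie_mode (hts : t * s = 1) (M N : ℕ) (h : 1 ≤ M + N) (i : ℤ) :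
    ⁅W.virasoroDefect t s M N, W.mode t i⁆ = 0 := by
  have hz : i + 1 - N + 1 - M = i + 1 - (M + N - 1 : ℕ) := by omega
  have hz' : i + 1 - M + 1 - N = i + 1 - (M + N - 1 : ℕ) := by omega
  rw [virasoroDefect, sub_lie, lie_lie, smul_lie]
  simp only [W.virasoroEnd_lie_mode t s hts, lie_smul_end, smul_smul, ← map_mul, hz, hz']
  rw [← sub_smul, ← sub_smul, ← map_sub, ← map_sub]
  obtain ⟨S, hS⟩ : ∃ S, M + N = S + 1 := ⟨M + N - 1, by omega⟩
  have hS' : M + N - 1 = S := by omega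
  have hp : (2 : ℚ) ^ M * 2 ^ N = 2 * 2 ^ S := by rw [← pow_add, hS, pow_succ]; ring
  convert zero_smul A _
  rw [hS']
  have e : ∀ a b : ℚ, a / 2 ^ N * (b / 2 ^ M) = a * b / (2 * 2 ^ S) := fun a b => by
    rw [← hp]; field_simp
  have e' : ∀ a b : ℚ, a / 2 ^ M * (b / 2 ^ N) = a * b / (2 * 2 ^ S) := fun a b => by
    rw [← hp]; field_simp
  rw [e, e', ← map_zero c]
  congr 1
  push_cast
  field_simp
  ring

lemma virasoroDefect_apply (hts : t * s = 1) (M N : ℕ) (h : 1 ≤ M + N) (p : P) :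
    W.virasoroDefect t s M N p = p * W.virasoroDefect t s M N 1 := by
  have hX : ∀ (k : ℕ) (q : P),
      W.virasoroDefect t s M N (W.var k * q) = W.var k * W.virasoroDefect t s M N q := by
    intro k q
    have hk := W.virasoroDefect_lie_mode t s hts M N h k
    have h1 : ⁅W.virasoroDefect t s M N, (if k = 1 then 1 else 0 : Module.End A P)⁆ = 0 := by
      split_ifs
      · exact lie_one_end _
      · exact lie_zero _
    rw [W.mode_natCast, lie_smul_end, lie_sub, h1, sub_zero] at hk
    have hk' := congrArg (fun a => c (oddFac k) • a) hk
    simp only [smul_smul, ← map_mul, smul_zero] at hk'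
    rw [mul_one_div_cancel (oddFac_ne_zero k), map_one, one_smul] at hk'
    have := congrArg (fun a => a q) hk'
    simpa [Ring.lie_def, mulEnd, sub_eq_zero] using this
  exact W.apply_eq_mul _ hX p

lemma virasoroEnd_one (N : ℕ) : W.virasoroEnd t s N 1 =
    (if N = 0 then (s * c (1 / 2 : ℚ)) • (W.var 0 * W.var 0)
      else 0) + (if N = 1 then c (1 / 16 : ℚ) • 1 else 0) := by
  have h : ∀ i, W.derEnd i (1 : P) = 0 := fun i => by simp [derEnd]
  simp only [virasoroEnd, LinearMap.add_apply, LinearMap.neg_apply, LinearMap.smul_apply,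
    LinearMap.sum_apply, Module.End.mul_apply, h, map_zero, smul_zero, Finset.sum_const_zero,
    Derivation.coeFn_coe, Derivation.map_one_eq_zero, neg_zero, zero_add]
  congr 1
  · split_ifs <;> simp [mulEnd]
  · split_ifs <;> simp

lemma virasoroEnd_sq (N : ℕ) :
    W.virasoroEnd t s N (W.var 0 * W.var 0) = W.var 0 * W.var 0 * W.virasoroEnd t s N 1 +
    c (1 / 2 ^ N : ℚ) • (W.var 0 * W.mode t (1 - N) 1 + W.mode t (1 - N) (W.var 0)) := by
  have h : ∀ q, W.virasoroEnd t s N (W.var 0 * q) = W.var 0 * W.virasoroEnd t s N q +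
      c (1 / 2 ^ N : ℚ) • W.mode t (1 - N) q := fun q => by
    have h := congrArg (fun a => a q) (W.virasoroEnd_lie_X t s N 0)
    have h1 : oddFac 1 = 1 := by simp [oddFac, doubleFac]
    simp only [Ring.lie_def, mulEnd, LinearMap.sub_apply, Module.End.mul_apply,
      LinearMap.mulLeft_apply, sub_eq_iff_eq_add, zero_add, h1, LinearMap.smul_apply,
      Nat.cast_zero] at h
    rw [h, add_comm]
  have h1 := h 1
  rw [mul_one] at h1
  rw [h, h1, mul_add, mul_smul_comm, mul_assoc, smul_add, add_assoc]

lemma virasoroDefect_zero_one (hts : t * s = 1) (N : ℕ) (h : 1 ≤ N) :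
    W.virasoroDefect t s 0 N 1 = 0 := by
  have hc : ∀ i k, W.mode t (-(i + 1 : ℕ)) (W.var k) =
      if i = k then (t * c (oddFac (i + 1))) • 1 else 0 := by
    intro i k
    rw [W.mode_neg t i (by push_cast; ring), LinearMap.smul_apply, derEnd, Derivation.coeFn_coe,
      W.der_var]
    split_ifs <;> simp
  have h1 : ∀ i : ℕ, W.mode t (-(i + 1 : ℕ)) 1 = 0 := by
    intro i
    rw [W.mode_neg t i (by push_cast; ring), LinearMap.smul_apply, derEnd, Derivation.coeFn_coe,
      Derivation.map_one_eq_zero, smul_zero]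
  have hzero : W.virasoroEnd t s 0 1 = (s * c (1 / 2)) • (W.var 0 * W.var 0) := by
    simp [W.virasoroEnd_one]
  rw [virasoroDefect, Ring.lie_def, LinearMap.sub_apply, LinearMap.sub_apply,
    Module.End.mul_apply, Module.End.mul_apply, LinearMap.smul_apply, hzero, map_smul,
    W.virasoroEnd_sq, zero_add]
  obtain rfl | rfl | ⟨K, rfl⟩ : N = 1 ∨ N = 2 ∨ ∃ K, N = K + 3 := by
    rcases N with _ | _ | _ | K
    · omega
    · simp
    · simp
    · exact Or.inr (Or.inr ⟨K, rfl⟩)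
  · have hm : W.mode t (1 - (1 : ℕ)) = mulEnd A (W.var 0) := by
      rw [show (1 : ℤ) - (1 : ℕ) = (0 : ℕ) by simp, W.mode_natCast]
      simp [oddFac_zero]
    have hone : W.virasoroEnd t s 1 1 = c (1 / 16) • 1 := by simp [W.virasoroEnd_one]
    rw [hm, hone, map_smul, hzero]
    simp only [mulEnd, LinearMap.mulLeft_apply, mul_one, mul_smul_comm, ← two_smul A,
      smul_smul, ← add_smul]
    have h2 : c (1 / 2 ^ 1) * 2 = 1 := by
      rw [← map_ofNat c 2, ← map_mul]
      simp
    have h3 : c (((0 : ℕ) : ℚ) - (1 : ℕ)) = -1 := by simp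
    rw [h2, h3]
    match_scalars
    ring
  · have hm : (1 : ℤ) - (2 : ℕ) = -(0 + 1 : ℕ) := by norm_num
    have hone : W.virasoroEnd t s (2 - 1) 1 = c (1 / 16) • 1 := by simp [W.virasoroEnd_one]
    have htwo : W.virasoroEnd t s 2 1 = 0 := by simp [W.virasoroEnd_one]
    have ho : oddFac (0 + 1) = 1 := by simp [oddFac, doubleFac]
    rw [hm, h1, hc, hone, htwo, if_pos rfl, ho]
    simp only [map_zero, mul_zero, zero_add, zero_sub, map_one, mul_one, smul_smul, ← neg_smul,
      ← sub_smul]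
    convert zero_smul A _
    calc _ = -(t * s) * c (1 / 2 * (1 / 2 ^ 2)) - c (((0 : ℕ) - (2 : ℕ)) * (1 / 16)) := by
          rw [map_mul, map_mul]
          ring
      _ = 0 := by
        rw [hts, neg_mul, one_mul, ← map_neg, ← map_sub, ← map_zero c]
        norm_num
  · have hm : (1 : ℤ) - (K + 3 : ℕ) = -(K + 1 + 1 : ℕ) := by push_cast; ring
    have hone : W.virasoroEnd t s (K + 3 - 1) 1 = 0 := by simp [W.virasoroEnd_one]
    have htwo : W.virasoroEnd t s (K + 3) 1 = 0 := by simp [W.virasoroEnd_one]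
    rw [hm, h1, hc, hone, htwo, if_neg (by omega)]
    simp

lemma virasoroDefect_one (hts : t * s = 1) (M N : ℕ) (h : 1 ≤ M + N) :
    W.virasoroDefect t s M N 1 = 0 := by
  have swap : W.virasoroDefect t s M N = -W.virasoroDefect t s N M := by
    rw [virasoroDefect, virasoroDefect, ← lie_skew, add_comm N M, ← neg_sub (N : ℚ) M, map_neg]
    module
  rcases Nat.eq_zero_or_pos M with rfl | hM
  · exact W.virasoroDefect_zero_one t s hts N (by omega)
  rcases Nat.eq_zero_or_pos N with rfl | hN
  · rw [swap, LinearMap.neg_apply, W.virasoroDefect_zero_one t s hts M (by omega), neg_zero]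
  have e : ∀ K, 1 ≤ K → W.virasoroEnd t s K 1 =
      (if K = 1 then c (1 / 16 : ℚ) else 0) • 1 := fun K hK => by
    rw [W.virasoroEnd_one, if_neg (by omega), zero_add]
    split_ifs <;> simp
  simp only [virasoroDefect, Ring.lie_def, LinearMap.sub_apply, Module.End.mul_apply,
    LinearMap.smul_apply, e M hM, e N hN, map_smul, e (M + N - 1) (by omega)]
  rw [smul_smul, smul_smul, mul_comm, sub_self, zero_sub, neg_eq_zero]
  by_cases h1 : M + N - 1 = 1
  · have : M = 1 := by omega
    have : N = 1 := by omega
    simp [*]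
  · simp [h1]

end VirasoroSetting

section Field

open MvPolynomial

variable {A : Type*} [CommRing A] (c : ℚ →+* A)

/-- The derivation `Σ_{i + N ≥ 1} ((2i+2N−1)!!/((2i−1)!!·2^N))·uᵢ·∂_{i+N−1}`, given by its
values on the variables. -/
noncomputable def virasoroField (N : ℕ) : Derivation A (MvPolynomial ℕ A) (MvPolynomial ℕ A) :=
  mkDerivation A fun k =>
    if N ≤ k + 1 then
      c (oddFac (k + 1) / (oddFac (k + 1 - N) * 2 ^ N)) • X (k + 1 - N)
    else 0

lemma finsum_eq_virasoroField (N : ℕ) (p : MvPolynomial ℕ A) :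
    (∑ᶠ i : ℕ, if 1 ≤ i + N then
      c (oddFac (i + N) / (oddFac i * 2 ^ N)) •
        (X i * pderiv (i + N - 1) p) else 0) = virasoroField c N p := by
  set B := p.vars.sup id + 2 with hB
  have hvars : ∀ k ∈ p.vars, k + 2 ≤ B := fun k hk => by
    have := Finset.le_sup (f := id) hk
    simp only [id] at this
    omega
  rw [finsum_eq_sum_of_support_subset (s := Finset.range B)]
  · let D : Derivation A (MvPolynomial ℕ A) (MvPolynomial ℕ A) := ∑ i ∈ Finset.range B,
      if 1 ≤ i + N then
        c (oddFac (i + N) / (oddFac i * 2 ^ N)) •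
          ((X i : MvPolynomial ℕ A) • pderiv (i + N - 1)) else 0
    have hD : ∀ q, D q = ∑ i ∈ Finset.range B, if 1 ≤ i + N then
      c (oddFac (i + N) / (oddFac i * 2 ^ N)) •
        (X i * pderiv (i + N - 1) q) else 0 := fun q => by
      have h : D q = ∑ i ∈ Finset.range B, (if 1 ≤ i + N then
        c (oddFac (i + N) / (oddFac i * 2 ^ N)) •
          ((X i : MvPolynomial ℕ A) • pderiv (i + N - 1)) else 0 :
            Derivation A (MvPolynomial ℕ A) (MvPolynomial ℕ A)) q := by
        rw [← Derivation.coeFnAddMonoidHom_apply, map_sum, Finset.sum_apply]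
        rfl
      rw [h]
      refine Finset.sum_congr rfl fun i _ => ?_
      split_ifs <;> simp
    rw [← hD]
    refine derivation_eq_of_forall_mem_vars fun k hk => ?_
    have hk := hvars k hk
    rw [hD, virasoroField, mkDerivation_X]
    split_ifs with hN
    · rw [Finset.sum_eq_single_of_mem (k + 1 - N)]
      · rw [if_pos (by omega), show k + 1 - N + N = k + 1 by omega]
        simp
      · simp only [Finset.mem_range]
        omega
      · intro i _ hi
        split_ifs
        · rw [pderiv_X_of_ne (by omega), mul_zero, smul_zero]
        · rfl
    · refine Finset.sum_eq_zero fun i _ => ?_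
      split_ifs
      · rw [pderiv_X_of_ne (by omega), mul_zero, smul_zero]
      · rfl
  · intro i hi
    by_contra h
    apply hi
    have h : B ≤ i := by simpa using h
    dsimp only
    split_ifs
    · rw [pderiv_eq_zero_of_notMem_vars, mul_zero, smul_zero]
      intro h'
      have := hvars _ h'
      omega
    · rfl

/-- The polynomial ring `A[u₀, u₁, …]` with its partial derivatives. -/
noncomputable def mvPolynomialSetting : VirasoroSetting c (MvPolynomial ℕ A) where
  var := X
  der i := pderiv i
  field := virasoroField c
  adjoin_var := adjoin_range_X
  der_var i k := by
    split_ifs with h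
    · rw [h, pderiv_X_self]
    · rw [pderiv_X_of_ne (Ne.symm h)]
  field_var N k := by rw [virasoroField, mkDerivation_X]

end Field

lemma Lop_eq (N : ℕ) (p : RPoly) : Lop ((N : ℤ) - 1) p =
    (mvPolynomialSetting LaurentPolynomial.C).virasoroEnd
      (LaurentPolynomial.T 2) (LaurentPolynomial.T (-2)) N p := by
  unfold Lop
  have h0 : ((N : ℤ) - 1 + 1).toNat = N := by omega
  have h1 : ((N : ℤ) - 1).toNat = N - 1 := by omega
  have h2 : ((N : ℤ) - 1 = -1) = (N = 0) := by simp
  have h3 : ((N : ℤ) - 1 = 0) = (N = 1) := propext (by omega)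
  simp only [h0, h1, h2, h3]
  rw [VirasoroSetting.virasoroEnd]
  refine congrArg₂ (· + ·) (congrArg₂ (· + ·) (congrArg₂ (· + ·) (congrArg₂ (· + ·) ?_ ?_) ?_) ?_) ?_
  · rw [doubleFac_toNat (k := N + 1) (by push_cast; ring)]
    rfl
  · refine Eq.trans (finsum_congr fun i => ?_) (finsum_eq_virasoroField LaurentPolynomial.C N p)
    by_cases h : 1 ≤ i + N
    · rw [if_pos h, if_pos (by omega), doubleFac_toNat (k := i + N) (by push_cast; ring),
        doubleFac_toNat (k := i) rfl, show ((i : ℤ) + (N - 1)).toNat = i + N - 1 by omega]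
    · rw [if_neg h, if_neg (by omega)]
  · refine congrArg (_ • ·) ?_
    rw [LinearMap.sum_apply]
    refine Finset.sum_congr rfl fun i hi => ?_
    rw [Finset.mem_range] at hi
    rw [doubleFac_toNat (k := N - 1 - i) (by omega),
      show ((N : ℤ) - 1 - 1 - i).toNat = N - 2 - i by omega]
    rfl
  · split_ifs <;> rfl
  · split_ifs <;> rfl

/-- The Virasoro relations `[L_m, L_n] = (m − n)·L_{m+n}` for all
`m, n ≥ −1`. -/
theorem virasoro_relation (m n : ℤ) (hm : -1 ≤ m) (hn : -1 ≤ n) (p : RPoly) :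
    Lop m (Lop n p) - Lop n (Lop m p) =
      LaurentPolynomial.C ((m : ℚ) - (n : ℚ)) • Lop (m + n) p := by
  obtain ⟨M, rfl⟩ : ∃ M : ℕ, m = M - 1 := ⟨(m + 1).toNat, by omega⟩
  obtain ⟨N, rfl⟩ : ∃ N : ℕ, n = N - 1 := ⟨(n + 1).toNat, by omega⟩
  have hts : (LaurentPolynomial.T 2 * LaurentPolynomial.T (-2) : ALaur) = 1 := by
    rw [← LaurentPolynomial.T_add]
    simp
  by_cases h : 1 ≤ M + N
  · have hd := (mvPolynomialSetting LaurentPolynomial.C).virasoroDefect_apply _ _ hts M N h p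
    rw [(mvPolynomialSetting LaurentPolynomial.C).virasoroDefect_one _ _ hts M N h, mul_zero,
      VirasoroSetting.virasoroDefect, LinearMap.sub_apply, sub_eq_zero,
      Ring.lie_def] at hd
    rw [Lop_eq, Lop_eq, Lop_eq, Lop_eq,
      show (M : ℤ) - 1 + (N - 1) = ((M + N - 1 : ℕ) : ℤ) - 1 by omega, Lop_eq]
    push_cast
    rw [sub_sub_sub_cancel_right]
    exact hd
  · have hM : M = 0 := by omega
    have hN : N = 0 := by omega
    subst hM hN
    simp
end
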